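/- arXiv:0902.2843 — 2 statements merged into one kernel-verified Lean document; each statement's English description precedes it below -/
import Mathlib

section
/- The function θ_KT satisfies the following four quasi-periodicity conditions for all (x,y,z,t) ∈ ℝ⁴: θ_KT(x+1, y, z+y, t) = exp(−2πi(z+ix))·θ_KT(x,y,z,t); θ_KT(x, y+1, z, t) = θ_KT(x,y,z,t); θ_KT(x, y, z+1, t) = θ_KT(x,y,z,t); and θ_KT(x, y, z, t+1) = exp(−2πi(y+it))·θ_KT(x,y,z,t). -/
open Complex

/-- The theta function `θ(z,τ) = Σ_{n∈ℤ} exp(2πi n z + π i n(n−1) τ)`. -/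
noncomputable def theta (z τ : ℂ) : ℂ :=
  ∑' n : ℤ, Complex.exp (2 * Real.pi * Complex.I * n * z +
    Real.pi * Complex.I * n * (n - 1) * τ)

/-- The theta function on the Kodaira–Thurston manifold:
`θ_KT(x,y,z,t) = θ(z+ix, y+i)·θ(y+it, i)`. -/
noncomputable def thetaKT (x y z t : ℝ) : ℂ :=
  theta ((z : ℂ) + Complex.I * x) ((y : ℂ) + Complex.I) *
    theta ((y : ℂ) + Complex.I * t) Complex.I

/-- `θ` is `1`-periodic in its first argument. -/
theorem theta_add_one (z τ : ℂ) : theta (z + 1) τ = theta z τ := by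
  unfold theta
  refine tsum_congr fun n ↦ Complex.exp_eq_exp_iff_exists_int.mpr ⟨n, ?_⟩
  ring

/-- `θ` is `1`-periodic in the modular parameter. -/
theorem theta_add_one_right (z τ : ℂ) : theta z (τ + 1) = theta z τ := by
  unfold theta
  refine tsum_congr fun n ↦ ?_
  obtain ⟨k, hk⟩ := Int.even_mul_pred_self n
  have hk' : (n : ℂ) * (n - 1) = k + k := by exact_mod_cast hk
  refine Complex.exp_eq_exp_iff_exists_int.mpr ⟨k, ?_⟩
  linear_combination (Real.pi * Complex.I : ℂ) * hk'

/-- `θ` is quasi-periodic under translation of its first argument by `τ`. -/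
theorem theta_add_tau (z τ : ℂ) :
    theta (z + τ) τ = Complex.exp (-(2 * Real.pi * Complex.I * z)) * theta z τ := by
  unfold theta
  rw [← tsum_mul_left]
  symm
  rw [← (Equiv.addRight (1 : ℤ)).tsum_eq]
  refine tsum_congr fun n ↦ ?_
  rw [← Complex.exp_add]
  congr 1
  simp only [Equiv.coe_addRight]
  push_cast
  ring

/-- Quasi-periodicity of `θ_KT` under the generators of the group `Γ`. -/
theorem thetaKT_quasiperiodic (x y z t : ℝ) :
    thetaKT (x + 1) y (z + y) t =
      Complex.exp (-(2 * Real.pi * Complex.I * ((z : ℂ) + Complex.I * x))) *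
        thetaKT x y z t ∧
    thetaKT x (y + 1) z t = thetaKT x y z t ∧
    thetaKT x y (z + 1) t = thetaKT x y z t ∧
    thetaKT x y z (t + 1) =
      Complex.exp (-(2 * Real.pi * Complex.I * ((y : ℂ) + Complex.I * t))) *
        thetaKT x y z t := by
  unfold thetaKT
  refine ⟨?_, ?_, ?_, ?_⟩
  · rw [← mul_assoc, ← theta_add_tau]
    push_cast
    ring_nf
  · rw [← theta_add_one_right (z + Complex.I * x) (y + Complex.I),
      ← theta_add_one (y + Complex.I * t)]
    push_cast
    ring_nf
  · rw [← theta_add_one (z + Complex.I * x)]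
    push_cast
    ring_nf
  · rw [mul_left_comm, ← theta_add_tau]
    push_cast
    ring_nf
end

section
/- Let u = (x,y,z,t) and v = (x',y',z',t') be points of ℝ⁴ that are not equivalent under the group Γ generated by the transformations a, b, c, d (i.e., λ·u ≠ v for every λ in the subgroup of bijections of ℝ⁴ generated by a, b, c, d). Then there exist α, β, γ, δ ∈ ℂ such that the function s(x,y,z,t) = θ(z+ix+α, y+i)·θ(z+ix+β, y+i)·θ(z+ix−α−β, y+i)·θ(y+it+γ, i)·θ(y+it+δ, i)·θ(y+it−γ−δ, i) satisfies s(u) = 0 and s(v) ≠ 0. -/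
open Complex

/-- The generator `a : (x,y,z,t) ↦ (x+1, y, z+y, t)` of `Γ`. -/
def genA : Equiv.Perm (ℝ × ℝ × ℝ × ℝ) where
  toFun p := (p.1 + 1, p.2.1, p.2.2.1 + p.2.1, p.2.2.2)
  invFun p := (p.1 - 1, p.2.1, p.2.2.1 - p.2.1, p.2.2.2)
  left_inv p := by obtain ⟨x, y, z, t⟩ := p; simp
  right_inv p := by obtain ⟨x, y, z, t⟩ := p; simp

/-- The generator `b : (x,y,z,t) ↦ (x, y+1, z, t)` of `Γ`. -/
def genB : Equiv.Perm (ℝ × ℝ × ℝ × ℝ) where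
  toFun p := (p.1, p.2.1 + 1, p.2.2.1, p.2.2.2)
  invFun p := (p.1, p.2.1 - 1, p.2.2.1, p.2.2.2)
  left_inv p := by obtain ⟨x, y, z, t⟩ := p; simp
  right_inv p := by obtain ⟨x, y, z, t⟩ := p; simp

/-- The generator `c : (x,y,z,t) ↦ (x, y, z+1, t)` of `Γ`. -/
def genC : Equiv.Perm (ℝ × ℝ × ℝ × ℝ) where
  toFun p := (p.1, p.2.1, p.2.2.1 + 1, p.2.2.2)
  invFun p := (p.1, p.2.1, p.2.2.1 - 1, p.2.2.2)
  left_inv p := by obtain ⟨x, y, z, t⟩ := p; simp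
  right_inv p := by obtain ⟨x, y, z, t⟩ := p; simp

/-- The generator `d : (x,y,z,t) ↦ (x, y, z, t+1)` of `Γ`. -/
def genD : Equiv.Perm (ℝ × ℝ × ℝ × ℝ) where
  toFun p := (p.1, p.2.1, p.2.2.1, p.2.2.2 + 1)
  invFun p := (p.1, p.2.1, p.2.2.1, p.2.2.2 - 1)
  left_inv p := by obtain ⟨x, y, z, t⟩ := p; simp
  right_inv p := by obtain ⟨x, y, z, t⟩ := p; simp

/-- The group `Γ` defining the Kodaira–Thurston manifold. -/
def GammaKT : Subgroup (Equiv.Perm (ℝ × ℝ × ℝ × ℝ)) :=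
  Subgroup.closure {genA, genB, genC, genD}

/-- The section `s(x,y,z,t) = θ(z+ix+α,y+i)·θ(z+ix+β,y+i)·θ(z+ix−α−β,y+i)·
θ(y+it+γ,i)·θ(y+it+δ,i)·θ(y+it−γ−δ,i)`. -/
noncomputable def sectionKT (α β γ δ : ℂ) (p : ℝ × ℝ × ℝ × ℝ) : ℂ :=
  theta ((p.2.2.1 : ℂ) + Complex.I * p.1 + α) ((p.2.1 : ℂ) + Complex.I) *
  theta ((p.2.2.1 : ℂ) + Complex.I * p.1 + β) ((p.2.1 : ℂ) + Complex.I) *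
  theta ((p.2.2.1 : ℂ) + Complex.I * p.1 - α - β) ((p.2.1 : ℂ) + Complex.I) *
  theta ((p.2.1 : ℂ) + Complex.I * p.2.2.2 + γ) Complex.I *
  theta ((p.2.1 : ℂ) + Complex.I * p.2.2.2 + δ) Complex.I *
  theta ((p.2.1 : ℂ) + Complex.I * p.2.2.2 - γ - δ) Complex.I

lemma theta_eq_jacobiTheta₂ (z τ : ℂ) : theta z τ = jacobiTheta₂ (z - τ / 2) τ := by
  unfold theta jacobiTheta₂ jacobiTheta₂_term
  refine tsum_congr fun n => ?_
  congr 1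
  ring

lemma summable_theta_terms (z : ℂ) {τ : ℂ} (hτ : 0 < τ.im) :
    Summable fun n : ℤ => Complex.exp (2 * Real.pi * Complex.I * n * z +
      Real.pi * Complex.I * n * (n - 1) * τ) := by
  refine ((summable_jacobiTheta₂_term_iff (z - τ / 2) τ).2 hτ).congr fun n => ?_
  unfold jacobiTheta₂_term
  congr 1
  ring

lemma theta_add_self (z τ : ℂ) :
    theta (z + τ) τ = Complex.exp (-2 * Real.pi * Complex.I * z) * theta z τ := by
  have e : z + τ - τ / 2 = z - τ / 2 + τ := by ring
  rw [theta_eq_jacobiTheta₂, theta_eq_jacobiTheta₂, e, jacobiTheta₂_add_left']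
  congr 2
  ring

lemma theta_add_self_eq_zero_iff (z τ : ℂ) : theta (z + τ) τ = 0 ↔ theta z τ = 0 := by
  simp [theta_add_self, Complex.exp_ne_zero]

lemma theta_add_int_mul_eq_zero_iff (z τ : ℂ) (l : ℤ) :
    theta (z + l * τ) τ = 0 ↔ theta z τ = 0 := by
  induction l using Int.induction_on with
  | zero => simp
  | succ i ih =>
    rw [← ih, ← theta_add_self_eq_zero_iff (z + (i : ℤ) * τ)]
    push_cast
    ring_nf
  | pred i ih =>
    rw [← ih, ← theta_add_self_eq_zero_iff]
    push_cast
    ring_nf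

/-- The theta series with the terms of index `-m` and `m + 1` paired. -/
lemma hasSum_theta_paired (z : ℂ) {τ : ℂ} (hτ : 0 < τ.im) :
    HasSum (fun m : ℕ => Complex.exp (Real.pi * Complex.I * m * (m + 1) * τ) *
      (Complex.exp (2 * Real.pi * Complex.I * z) ^ (-(m : ℤ)) +
        Complex.exp (2 * Real.pi * Complex.I * z) ^ (m + 1))) (theta z τ) := by
  have h := (Equiv.neg ℤ).hasSum_iff.2 (summable_theta_terms z hτ).hasSum
  have h' := h.nat_add_neg_add_one
  unfold theta
  convert h' using 2 with m
  simp only [Function.comp_apply, Equiv.neg_apply, mul_add, ← Complex.exp_int_mul,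
    ← Complex.exp_nat_mul, ← Complex.exp_add]
  push_cast
  congr 2 <;> ring

lemma theta_one_half (τ : ℂ) (hτ : 0 < τ.im) : theta (1 / 2) τ = 0 := by
  refine (hasSum_theta_paired (1 / 2) hτ).unique ?_
  have hw : Complex.exp (2 * Real.pi * Complex.I * (1 / 2)) = -1 := by
    rw [← Complex.exp_pi_mul_I]
    congr 1
    ring
  convert hasSum_zero with m
  rw [hw]
  rcases Nat.even_or_odd m with hm | hm <;> simp [pow_succ, hm.neg_one_pow]

lemma norm_zpow_neg_add_pow_succ_le {w : ℂ} {R : ℝ} (hw : w ≠ 0) (h₁ : ‖w‖ ≤ R)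
    (h₂ : ‖w‖⁻¹ ≤ R) (m : ℕ) :
    ‖w ^ (-(m : ℤ)) + w ^ (m + 1)‖ ≤ ‖1 + w‖ * ((2 * m + 1) * R ^ m) := by
  induction m with
  | zero => simp
  | succ m ih =>
    have key : w ^ (-((m + 1 : ℕ) : ℤ)) + w ^ (m + 1 + 1) =
        (1 + w) * (w⁻¹ ^ (m + 1) + w ^ (m + 1)) - (w ^ (-(m : ℤ)) + w ^ (m + 1)) := by
      simp only [zpow_neg, zpow_natCast, inv_pow]
      field_simp
      ring
    have hR : 1 ≤ R := by
      rcases le_total 1 ‖w‖ with h | h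
      · exact h.trans h₁
      · exact ((one_le_inv₀ (norm_pos_iff.2 hw)).2 h).trans h₂
    have h₃ : ‖w⁻¹ ^ (m + 1) + w ^ (m + 1)‖ ≤ 2 * R ^ (m + 1) := by
      refine (norm_add_le _ _).trans ?_
      rw [norm_pow, norm_pow, norm_inv, two_mul]
      gcongr
    have h₄ : (2 * m + 1) * R ^ m ≤ (2 * m + 1) * R ^ (m + 1) := by
      gcongr ?_ * ?_
      exact pow_le_pow_right₀ hR m.le_succ
    rw [key]
    calc _ ≤ ‖1 + w‖ * (2 * R ^ (m + 1)) + ‖1 + w‖ * ((2 * m + 1) * R ^ (m + 1)) := by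
          refine (norm_sub_le _ _).trans (add_le_add ?_ (ih.trans ?_))
          · rw [norm_mul]
            gcongr
          · gcongr
      _ = _ := by push_cast; ring

lemma exp_neg_pi_le : Real.exp (-Real.pi) ≤ 1 / 20 := by
  rw [Real.exp_neg, inv_eq_one_div]
  refine one_div_le_one_div_of_le (by norm_num) ?_
  calc (20 : ℝ) ≤ 2.7182818283 ^ 3 := by norm_num
    _ ≤ Real.exp 1 ^ 3 := by
      gcongr
      exact Real.exp_one_gt_d9.le
    _ = Real.exp 3 := by rw [← Real.exp_nat_mul]; norm_num
    _ ≤ Real.exp Real.pi := Real.exp_le_exp.2 Real.pi_gt_three.le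

lemma exp_neg_mul_pow_le (m : ℕ) :
    Real.exp (-(Real.pi * (m * (m + 1)))) * ((2 * m + 1) * Real.exp Real.pi ^ m) ≤
      (3 / 20) ^ m := by
  have h₁ : (2 * m + 1 : ℝ) ≤ 3 ^ m := by
    have := one_add_mul_le_pow (show (-2 : ℝ) ≤ 2 by norm_num) m
    norm_num at this
    linarith
  have h₂ : Real.exp (-(Real.pi * (m * (m + 1)))) * Real.exp Real.pi ^ m ≤ (1 / 20) ^ m := by
    calc _ = Real.exp (-(Real.pi * (m * m))) := by
          rw [← Real.exp_nat_mul, ← Real.exp_add]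
          congr 1
          ring
      _ ≤ Real.exp (m * -Real.pi) := by
          rw [Real.exp_le_exp]
          have : (m : ℝ) ≤ m * m := by exact_mod_cast Nat.le_mul_self m
          nlinarith [Real.pi_pos]
      _ = Real.exp (-Real.pi) ^ m := Real.exp_nat_mul _ _
      _ ≤ _ := by
          gcongr
          exact exp_neg_pi_le
  calc _ = (2 * m + 1) *
        (Real.exp (-(Real.pi * (m * (m + 1)))) * Real.exp Real.pi ^ m) := by ring
    _ ≤ 3 ^ m * (1 / 20) ^ m := by gcongr
    _ = _ := by rw [← mul_pow]; norm_num

lemma exp_eq_neg_one_of_theta_eq_zero {z τ : ℂ} (hτ : τ.im = 1) (hz : |z.im| ≤ 1 / 2)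
    (h : theta z τ = 0) : Complex.exp (2 * Real.pi * Complex.I * z) = -1 := by
  set w := Complex.exp (2 * Real.pi * Complex.I * z) with hw
  have hnorm : ‖w‖ = Real.exp (-(2 * Real.pi * z.im)) := by
    rw [hw, Complex.norm_exp]
    simp
  obtain ⟨hz₁, hz₂⟩ := abs_le.1 hz
  have hpaired := hasSum_theta_paired z (by rw [hτ]; exact one_pos : 0 < τ.im)
  rw [h, ← hw, ← hasSum_nat_add_iff' 1] at hpaired
  have hgeom := ((hasSum_nat_add_iff' 1).2
    (hasSum_geometric_of_lt_one (r := 3 / 20) (by norm_num) (by norm_num))).mul_left ‖1 + w‖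
  have hle := hpaired.norm_le_of_bounded hgeom fun m => ?_
  · norm_num at hle
    rw [← norm_neg] at hle
    have : ‖1 + w‖ = 0 := by
      have := norm_nonneg (1 + w)
      simp only [neg_add_rev, neg_neg] at hle
      linarith
    exact (neg_eq_of_add_eq_zero_right (norm_eq_zero.1 this)).symm
  · have hb := norm_zpow_neg_add_pow_succ_le (w := w) (R := Real.exp Real.pi)
      (Complex.exp_ne_zero _)
      (by rw [hnorm, Real.exp_le_exp]; nlinarith [Real.pi_pos])
      (by rw [hnorm, ← Real.exp_neg, Real.exp_le_exp]; nlinarith [Real.pi_pos]) (m + 1)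
    have hq : ‖Complex.exp (Real.pi * Complex.I * (m + 1 : ℕ) * ((m + 1 : ℕ) + 1) * τ)‖ =
        Real.exp (-(Real.pi * ((m + 1 : ℕ) * ((m + 1 : ℕ) + 1)))) := by
      rw [Complex.norm_exp]
      congr 1
      simp [hτ]
      ring
    rw [norm_mul, hq]
    calc _ ≤ _ * _ := mul_le_mul_of_nonneg_left hb (Real.exp_pos _).le
      _ = ‖1 + w‖ * (_ * _) := by rw [mul_left_comm]
      _ ≤ _ := mul_le_mul_of_nonneg_left (exp_neg_mul_pow_le (m + 1)) (norm_nonneg _)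

/-- The zeros of `θ(·, τ)` for `Im τ = 1` form the coset `1/2 + ℤ + ℤτ`. -/
lemma exists_int_of_theta_eq_zero {z τ : ℂ} (hτ : τ.im = 1) (h : theta z τ = 0) :
    ∃ k l : ℤ, z = 1 / 2 + k + l * τ := by
  obtain ⟨n, hn⟩ := Complex.exp_eq_exp_iff_exists_int.1
    ((exp_eq_neg_one_of_theta_eq_zero (z := z + (-round z.im : ℤ) * τ) hτ
      (by simpa [hτ, ← sub_eq_add_neg] using abs_sub_round z.im)
      ((theta_add_int_mul_eq_zero_iff _ _ _).2 h)).trans Complex.exp_pi_mul_I.symm)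
  refine ⟨n, round z.im, ?_⟩
  have hpi : (2 * Real.pi * Complex.I : ℂ) ≠ 0 := Complex.two_pi_I_ne_zero
  apply mul_left_cancel₀ hpi
  push_cast at hn
  linear_combination hn

lemma exists_int_im_of_theta_eq_zero {z τ : ℂ} (hτ : τ.im = 1) (h : theta z τ = 0) :
    ∃ l : ℤ, z.im = l := by
  obtain ⟨k, l, rfl⟩ := exists_int_of_theta_eq_zero hτ h
  exact ⟨l, by simp [hτ]⟩

lemma exists_real_ne_int (A C : ℝ) :
    ∃ s : ℝ, (∀ l : ℤ, A + s ≠ l) ∧ ∀ l : ℤ, C - s ≠ l := by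
  have half : ∀ l : ℤ, (1 / 2 : ℝ) ≠ l := fun l hl => by
    have : (1 : ℤ) = 2 * l := by exact_mod_cast (by linarith : (1 : ℝ) = 2 * l)
    omega
  have quarter : ∀ l : ℤ, (1 / 4 : ℝ) ≠ l := fun l hl => by
    have : (1 : ℤ) = 4 * l := by exact_mod_cast (by linarith : (1 : ℝ) = 4 * l)
    omega
  by_cases hC : ∃ l : ℤ, C + A - 1 / 2 = l
  · obtain ⟨n, hn⟩ := hC
    refine ⟨1 / 4 - A, fun l hl => quarter l (by linarith), fun l hl => quarter (l - n) ?_⟩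
    push_cast
    linarith
  · push Not at hC
    exact ⟨1 / 2 - A, fun l hl => half l (by linarith), fun l hl => hC l (by linarith)⟩

lemma exists_theta_ne_zero (p c : ℂ) {τ : ℂ} (hτ : τ.im = 1) :
    ∃ δ : ℂ, theta (p + δ) τ ≠ 0 ∧ theta (c - δ) τ ≠ 0 := by
  obtain ⟨s, h₁, h₂⟩ := exists_real_ne_int p.im c.im
  refine ⟨s * Complex.I, fun h => ?_, fun h => ?_⟩
  · obtain ⟨l, hl⟩ := exists_int_im_of_theta_eq_zero hτ h
    exact h₁ l (by simpa using hl)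
  · obtain ⟨l, hl⟩ := exists_int_im_of_theta_eq_zero hτ h
    exact h₂ l (by simpa using hl)

/-- A product of three translated thetas can vanish at `p` and not at `p'`. -/
lemma exists_theta_mul_separating {p p' τ τ' : ℂ} (hτ : τ.im = 1) (hτ' : τ'.im = 1)
    (h : ∀ k l : ℤ, p' ≠ p + k + l * τ') :
    ∃ α β : ℂ, theta (p + α) τ = 0 ∧ theta (p' + α) τ' ≠ 0 ∧ theta (p' + β) τ' ≠ 0 ∧
      theta (p' - α - β) τ' ≠ 0 := by
  obtain ⟨β, h₁, h₂⟩ := exists_theta_ne_zero p' (p' - (1 / 2 - p)) hτ'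
  refine ⟨1 / 2 - p, β, ?_, fun h₀ => ?_, h₁, h₂⟩
  · rw [add_sub_cancel]
    exact theta_one_half τ (by rw [hτ]; exact one_pos)
  · obtain ⟨k, l, hkl⟩ := exists_int_of_theta_eq_zero hτ' h₀
    exact h k l (by linear_combination hkl)

lemma exists_theta_mul_ne_zero (p : ℂ) {τ : ℂ} (hτ : τ.im = 1) :
    ∃ α β : ℂ, theta (p + α) τ ≠ 0 ∧ theta (p + β) τ ≠ 0 ∧ theta (p - α - β) τ ≠ 0 := by
  obtain ⟨α, h, -⟩ := exists_theta_ne_zero p 0 hτ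
  obtain ⟨β, h₁, h₂⟩ := exists_theta_ne_zero p (p - α) hτ
  exact ⟨α, β, h, h₁, h₂⟩

lemma zpow_genA_apply (l : ℤ) (p : ℝ × ℝ × ℝ × ℝ) :
    (genA ^ l) p = (p.1 + l, p.2.1, p.2.2.1 + l * p.2.1, p.2.2.2) := by
  induction l using Int.induction_on with
  | zero => simp
  | succ i ih =>
    rw [add_comm, zpow_add, Equiv.Perm.mul_apply, ih]
    simp only [zpow_one, genA, Equiv.coe_fn_mk, Prod.mk.injEq, true_and, and_true]
    push_cast
    constructor <;> ring
  | pred i ih =>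
    rw [sub_eq_neg_add, zpow_add, Equiv.Perm.mul_apply, ih, zpow_neg_one, Equiv.Perm.inv_def]
    simp only [genA, Equiv.coe_fn_symm_mk, Prod.mk.injEq, true_and, and_true]
    push_cast
    constructor <;> ring

lemma zpow_genB_apply (l : ℤ) (p : ℝ × ℝ × ℝ × ℝ) :
    (genB ^ l) p = (p.1, p.2.1 + l, p.2.2.1, p.2.2.2) := by
  induction l using Int.induction_on with
  | zero => simp
  | succ i ih =>
    rw [add_comm, zpow_add, Equiv.Perm.mul_apply, ih]
    simp [genB]
    ring
  | pred i ih =>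
    rw [sub_eq_neg_add, zpow_add, Equiv.Perm.mul_apply, ih, zpow_neg_one, Equiv.Perm.inv_def]
    simp [genB]
    ring

lemma zpow_genC_apply (l : ℤ) (p : ℝ × ℝ × ℝ × ℝ) :
    (genC ^ l) p = (p.1, p.2.1, p.2.2.1 + l, p.2.2.2) := by
  induction l using Int.induction_on with
  | zero => simp
  | succ i ih =>
    rw [add_comm, zpow_add, Equiv.Perm.mul_apply, ih]
    simp [genC]
    ring
  | pred i ih =>
    rw [sub_eq_neg_add, zpow_add, Equiv.Perm.mul_apply, ih, zpow_neg_one, Equiv.Perm.inv_def]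
    simp [genC]
    ring

lemma zpow_genD_apply (l : ℤ) (p : ℝ × ℝ × ℝ × ℝ) :
    (genD ^ l) p = (p.1, p.2.1, p.2.2.1, p.2.2.2 + l) := by
  induction l using Int.induction_on with
  | zero => simp
  | succ i ih =>
    rw [add_comm, zpow_add, Equiv.Perm.mul_apply, ih]
    simp [genD]
    ring
  | pred i ih =>
    rw [sub_eq_neg_add, zpow_add, Equiv.Perm.mul_apply, ih, zpow_neg_one, Equiv.Perm.inv_def]
    simp [genD]
    ring

lemma exists_mem_GammaKT_apply (x y z t : ℝ) (k l m n : ℤ) :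
    ∃ g ∈ GammaKT, g (x, y, z, t) = (x + l, y + m, z + k + l * (y + m), t + n) := by
  refine ⟨genC ^ k * genA ^ l * genB ^ m * genD ^ n, ?_, ?_⟩
  · refine mul_mem (mul_mem (mul_mem ?_ ?_) ?_) ?_ <;>
      exact zpow_mem (Subgroup.subset_closure (by simp)) _
  · simp only [Equiv.Perm.mul_apply, zpow_genA_apply, zpow_genB_apply, zpow_genC_apply,
      zpow_genD_apply]
    ring_nf

/-- For points `u ≠ v` of `ℝ⁴` inequivalent under `Γ`, some theta function of
degree 3 on the Kodaira–Thurston manifold vanishes at `u` but not at `v`. -/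
theorem exists_section_separating (u v : ℝ × ℝ × ℝ × ℝ)
    (h : ∀ g ∈ GammaKT, g u ≠ v) :
    ∃ α β γ δ : ℂ, sectionKT α β γ δ u = 0 ∧ sectionKT α β γ δ v ≠ 0 := by
  obtain ⟨x, y, z, t⟩ := u
  obtain ⟨x', y', z', t'⟩ := v
  by_cases hyt : ∃ m n : ℤ, (y' + Complex.I * t' : ℂ) = y + Complex.I * t + m + n * Complex.I
  · obtain ⟨m, n, hmn⟩ := hyt
    have hy : y' = y + m := by simpa using congrArg Complex.re hmn
    have ht : t' = t + n := by simpa using congrArg Complex.im hmn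
    obtain ⟨α, β, h₀, h₁, h₂, h₃⟩ := exists_theta_mul_separating
      (p := z + Complex.I * x) (p' := z' + Complex.I * x') (τ := y + Complex.I)
      (τ' := y' + Complex.I) (by simp) (by simp) fun k l hkl => by
        have hx : x' = x + l := by simpa using congrArg Complex.im hkl
        have hz : z' = z + k + l * y' := by simpa using congrArg Complex.re hkl
        obtain ⟨g, hg, hgu⟩ := exists_mem_GammaKT_apply x y z t k l m n
        exact h g hg (by rw [hgu, ← hy, ← ht, ← hx, ← hz])
    obtain ⟨γ, δ, h₄, h₅, h₆⟩ := exists_theta_mul_ne_zero (y' + Complex.I * t') Complex.I_im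
    exact ⟨α, β, γ, δ, by simp [sectionKT, h₀], by simp [sectionKT, h₁, h₂, h₃, h₄, h₅, h₆]⟩
  · push Not at hyt
    obtain ⟨γ, δ, h₀, h₁, h₂, h₃⟩ := exists_theta_mul_separating Complex.I_im Complex.I_im hyt
    obtain ⟨α, β, h₄, h₅, h₆⟩ := exists_theta_mul_ne_zero (z' + Complex.I * x')
      (τ := y' + Complex.I) (by simp)
    exact ⟨α, β, γ, δ, by simp [sectionKT, h₀], by simp [sectionKT, h₁, h₂, h₃, h₄, h₅, h₆]⟩
end
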